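/- Let (p_n) ⊂ (1,2) be a nonincreasing sequence with p_n → 1. If (c_n) is a sequence in ℓ² converging in ℓ²-norm to c ∈ ℓ², then R̆_1(c) ≤ liminf_{n→∞} R̆_{p_n}(c_n), where the inequality is in [0,∞]. (Liminf inequality of the Γ-convergence of R̆_{p_n} to R̆_1 with respect to the ℓ² topology.) -/

import Mathlib

open scoped ENNReal

/-- The extended-real-valued functional `R̆_r : ℓ² → [0,∞]`,
`R̆_r(c) = (1/r) ∑_λ |c_λ|^r` if the sum is finite (i.e. `c ∈ ℓ^r`) and `∞` otherwise.
(Here the `ℝ≥0∞`-valued `tsum` is `∞` exactly when `fun λ => |c λ| ^ r` is not summable.) -/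
noncomputable def Rbreve (r : ℝ) (c : ℕ → ℝ) : ℝ≥0∞ :=
  ENNReal.ofReal (1 / r) * ∑' i, ENNReal.ofReal (|c i| ^ r)

open Filter MeasureTheory Topology in
/-- Fatou's lemma for series in `[0,∞]`. -/
lemma tsum_le_liminf_tsum_of_tendsto {f : ℕ → ℕ → ℝ≥0∞} {g : ℕ → ℝ≥0∞}
    (h : ∀ i, Tendsto (fun n => f n i) atTop (𝓝 (g i))) :
    ∑' i, g i ≤ liminf (fun n => ∑' i, f n i) atTop := by
  have key := lintegral_liminf_le (μ := Measure.count) (f := f) (u := atTop)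
    (fun n => measurable_of_countable (f n))
  simp only [lintegral_count] at key
  simpa only [(h _).liminf_eq] using key

open Filter Topology in
/-- Convergence in `ℓ²` implies coordinatewise convergence. -/
lemma tendsto_apply_of_tendsto_tsum_sub_sq {c : ℕ → ℕ → ℝ} {a : ℕ → ℝ}
    (hc : ∀ n, Summable fun i => (c n i) ^ 2) (ha : Summable fun i => (a i) ^ 2)
    (hconv : Tendsto (fun n => ∑' i, (c n i - a i) ^ 2) atTop (𝓝 0)) (i : ℕ) :
    Tendsto (fun n => c n i) atTop (𝓝 (a i)) := by
  have hsum (n : ℕ) : Summable fun j => (c n j - a j) ^ 2 :=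
    Summable.of_nonneg_of_le (fun _ => sq_nonneg _)
      (fun j => by nlinarith [sq_nonneg (c n j + a j)])
      (((hc n).mul_left 2).add (ha.mul_left 2))
  have hsq : Tendsto (fun n => (c n i - a i) ^ 2) atTop (𝓝 0) :=
    squeeze_zero (fun _ => sq_nonneg _)
      (fun n => (hsum n).le_tsum i fun _ _ => sq_nonneg _) hconv
  have habs : Tendsto (fun n => |c n i - a i|) atTop (𝓝 0) := by
    simpa only [Real.sqrt_sq_eq_abs, Real.sqrt_zero] using hsq.sqrt
  exact tendsto_sub_nhds_zero_iff.1 ((tendsto_zero_iff_abs_tendsto_zero _).2 habs)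

/-- liminf inequality of the Γ-convergence `R̆_{p_n} → R̆_1`, Theorem 5.2(i).
Let `(p n) ⊂ (1,2)` be nonincreasing with `p n → 1`.  If `(c n)` is a sequence in `ℓ²`
converging in `ℓ²`-norm to `climit ∈ ℓ²`, then
`R̆_1(climit) ≤ liminf_n R̆_{p_n}(c n)` in `[0,∞]`. -/
theorem stmt1 (p : ℕ → ℝ) (hmono : Antitone p) (hp : ∀ n, 1 < p n ∧ p n < 2)
    (hplim : Filter.Tendsto p Filter.atTop (nhds 1))
    (c : ℕ → ℕ → ℝ) (climit : ℕ → ℝ)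
    (hc2 : ∀ n, Summable fun i => (c n i) ^ 2)
    (hlim2 : Summable fun i => (climit i) ^ 2)
    (hconv : Filter.Tendsto (fun n => ∑' i, (c n i - climit i) ^ 2)
      Filter.atTop (nhds 0)) :
    Rbreve 1 climit ≤ Filter.liminf (fun n => Rbreve (p n) (c n)) Filter.atTop := by
  simp only [Rbreve, ← ENNReal.tsum_mul_left]
  refine tsum_le_liminf_tsum_of_tendsto fun i => ?_
  have hci := (tendsto_apply_of_tendsto_tsum_sub_sq hc2 hlim2 hconv i).abs
  have hinv : Filter.Tendsto (fun n => 1 / p n) Filter.atTop (nhds (1 / 1)) :=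
    tendsto_const_nhds.div hplim one_ne_zero
  exact ENNReal.Tendsto.mul (ENNReal.tendsto_ofReal hinv) (Or.inr ENNReal.ofReal_ne_top)
    (ENNReal.tendsto_ofReal (hci.rpow hplim (Or.inr one_pos))) (Or.inr ENNReal.ofReal_ne_top)
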